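/- If g₁,…,g_p are (not necessarily independent) centered Gaussian random variables each with variance at most σ², and g₁* ≥ … ≥ g_p* denotes the non-increasing rearrangement of |g₁|,…,|g_p|, then the event ∩_{j=1}^p { g_j* ≤ 4σ√(log(2p/j)) } has probability at least 1/2. -/

import Mathlib

open MeasureTheory ProbabilityTheory
open scoped ENNReal NNReal

/-- `rearr u j` is the `(j+1)`-th largest value among `|u₁|,…,|u_p|`
(the non-increasing rearrangement `u*`, `0`-indexed). -/
noncomputable def rearr {p : ℕ} (u : Fin p → ℝ) (j : Fin p) : ℝ :=
  ((Finset.univ.val.map fun i => |u i|).sort (· ≥ ·)).getD j 0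

/-- In a list sorted in non-increasing order, `k + 1` entries dominate the entry of index `k`. -/
lemma List.succ_mul_getElem_le_sum {α : Type*} [LinearOrder α] {l : List α} (hl : l.Pairwise (· ≥ ·))
    {f : α → ℝ} (hf : ∀ x ∈ l, 0 ≤ f x) (hmono : ∀ x ∈ l, ∀ y ∈ l, x ≤ y → f x ≤ f y)
    {k : ℕ} (hk : k < l.length) :
    ((k : ℝ) + 1) * f l[k] ≤ (l.map f).sum := by
  have h_take : (k + 1) • f l[k] ≤ ((l.take (k + 1)).map f).sum := by
    have h := List.card_nsmul_le_sum ((l.take (k + 1)).map f) (f l[k]) (by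
      intro y hy
      obtain ⟨x, hx, rfl⟩ := List.mem_map.1 hy
      obtain ⟨i, hi, rfl⟩ := List.mem_iff_getElem.1 hx
      rw [List.length_take] at hi
      rw [List.getElem_take]
      refine hmono _ (List.getElem_mem _) _ (List.getElem_mem _) ?_
      rcases Nat.lt_or_ge i k with hik | hik
      · exact List.pairwise_iff_getElem.1 hl i k _ hk hik
      · obtain rfl : i = k := by omega
        exact le_rfl)
    rwa [List.length_map, List.length_take, min_eq_left hk] at h
  have h_drop : 0 ≤ ((l.drop (k + 1)).map f).sum := by
    refine List.sum_nonneg fun y hy => ?_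
    obtain ⟨x, hx, rfl⟩ := List.mem_map.1 hy
    exact hf x (List.mem_of_mem_drop hx)
  have h_split : (l.map f).sum = ((l.take (k + 1)).map f).sum + ((l.drop (k + 1)).map f).sum := by
    rw [← List.sum_append, ← List.map_append, List.take_append_drop]
  rw [nsmul_eq_mul] at h_take
  push_cast at h_take
  linarith

lemma rearr_nonneg {p : ℕ} (u : Fin p → ℝ) (j : Fin p) : 0 ≤ rearr u j := by
  unfold rearr
  set l := (Finset.univ.val.map fun i => |u i|).sort (· ≥ ·) with hl
  have hj : (j : ℕ) < l.length := by simp [hl]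
  have h_mem : l.getD j 0 ∈ l := by
    rw [List.getD_eq_getElem _ _ hj]
    exact List.getElem_mem hj
  rw [hl, Multiset.mem_sort, Multiset.mem_map] at h_mem
  obtain ⟨i, -, hi⟩ := h_mem
  rw [hl, ← hi]
  exact abs_nonneg _

lemma succ_mul_rearr_le_sum {p : ℕ} (u : Fin p → ℝ) (j : Fin p) {f : ℝ → ℝ}
    (hf : ∀ x, 0 ≤ f x) (hmono : MonotoneOn f (Set.Ici 0)) :
    ((j : ℝ) + 1) * f (rearr u j) ≤ ∑ i, f |u i| := by
  unfold rearr
  set l := (Finset.univ.val.map fun i => |u i|).sort (· ≥ ·) with hl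
  have hj : (j : ℕ) < l.length := by simp [hl]
  have h_nonneg : ∀ x ∈ l, 0 ≤ x := by
    intro x hx
    rw [hl, Multiset.mem_sort, Multiset.mem_map] at hx
    obtain ⟨i, -, rfl⟩ := hx
    exact abs_nonneg _
  have h_sum : (l.map f).sum = ∑ i, f |u i| := by
    rw [← Multiset.sum_coe, ← Multiset.map_coe, hl, Multiset.sort_eq, Multiset.map_map]
    rfl
  rw [List.getD_eq_getElem _ _ hj, ← h_sum]
  exact List.succ_mul_getElem_le_sum (Multiset.pairwise_sort _ _) (fun x _ => hf x)
    (fun x hx y hy => hmono (h_nonneg x hx) (h_nonneg y hy)) hj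

lemma exp_mul_gaussianPDFReal {v : ℝ≥0} (hv : v ≠ 0) (x : ℝ) :
    Real.exp (x ^ 2 / (4 * v)) * gaussianPDFReal 0 v x = √2 * gaussianPDFReal 0 (2 * v) x := by
  have hv' : (v : ℝ) ≠ 0 := by exact_mod_cast hv
  have h_sqrt : (√(2 * Real.pi * v))⁻¹ = √2 * (√(2 * Real.pi * (2 * v)))⁻¹ := by
    rw [show 2 * Real.pi * (2 * (v : ℝ)) = 2 * (2 * Real.pi * v) by ring,
      Real.sqrt_mul (by norm_num : (0 : ℝ) ≤ 2), mul_inv, ← mul_assoc,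
      mul_inv_cancel₀ (by positivity), one_mul]
  simp only [gaussianPDFReal, sub_zero, NNReal.coe_mul, NNReal.coe_ofNat]
  rw [h_sqrt, mul_left_comm, ← Real.exp_add, mul_assoc]
  congr 3
  field_simp
  ring

lemma lintegral_exp_sq_gaussianReal_le {σ : ℝ} {v : ℝ≥0} (hv : (v : ℝ) ≤ σ ^ 2) :
    ∫⁻ x, ENNReal.ofReal (Real.exp (x ^ 2 / (4 * σ ^ 2))) ∂gaussianReal 0 v ≤ 2 := by
  rcases eq_or_ne v 0 with rfl | hv0
  · rw [gaussianReal_zero_var, lintegral_dirac' _ (by fun_prop)]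
    simp
  have hv_pos : (0 : ℝ) < v := by exact_mod_cast pos_iff_ne_zero.2 hv0
  calc ∫⁻ x, ENNReal.ofReal (Real.exp (x ^ 2 / (4 * σ ^ 2))) ∂gaussianReal 0 v
      ≤ ∫⁻ x, ENNReal.ofReal (Real.exp (x ^ 2 / (4 * v))) ∂gaussianReal 0 v := by
        gcongr
    _ = ∫⁻ x, ENNReal.ofReal √2 * gaussianPDF 0 (2 * v) x := by
        rw [gaussianReal_of_var_ne_zero _ hv0,
          lintegral_withDensity_eq_lintegral_mul _ (measurable_gaussianPDF _ _) (by fun_prop)]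
        refine lintegral_congr fun x => ?_
        rw [Pi.mul_apply, mul_comm, gaussianPDF, gaussianPDF, ← ENNReal.ofReal_mul (by positivity),
          ← ENNReal.ofReal_mul (by positivity), exp_mul_gaussianPDFReal hv0]
    _ = ENNReal.ofReal √2 := by
        rw [lintegral_const_mul _ (measurable_gaussianPDF _ _),
          lintegral_gaussianPDF_eq_one _ (by positivity), mul_one]
    _ ≤ 2 := by
        rw [← ENNReal.ofReal_ofNat]
        exact ENNReal.ofReal_le_ofReal (Real.sqrt_le_iff.2 (by norm_num))

lemma rearr_le_of_sum_exp_sq_le {p : ℕ} {σ : ℝ} (hσ : 0 < σ) {u : Fin p → ℝ}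
    (hu : ∑ i, Real.exp (u i ^ 2 / (4 * σ ^ 2)) ≤ 4 * p) (j : Fin p) :
    rearr u j ≤ 4 * σ * √(Real.log (2 * p / ((j : ℕ) + 1))) := by
  have hj : ((j : ℕ) : ℝ) + 1 ≤ p := by exact_mod_cast j.isLt
  have hj_pos : (0 : ℝ) < ((j : ℕ) : ℝ) + 1 := by positivity
  have h_main := succ_mul_rearr_le_sum u j (f := fun x => Real.exp (x ^ 2 / (4 * σ ^ 2)))
    (fun x => (Real.exp_pos _).le) (fun x hx y _ hxy => by
      have hx : 0 ≤ x := hx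
      dsimp only
      gcongr)
  simp only [sq_abs] at h_main
  set q : ℝ := 2 * p / ((j : ℕ) + 1) with hq
  have hq2 : 2 ≤ q := by
    rw [hq, le_div_iff₀ hj_pos]
    linarith
  have h_exp : Real.exp (rearr u j ^ 2 / (4 * σ ^ 2)) ≤ q * q := by
    calc Real.exp (rearr u j ^ 2 / (4 * σ ^ 2)) ≤ 4 * p / ((j : ℕ) + 1) := by
          rw [le_div_iff₀ hj_pos]
          linarith
      _ = 2 * q := by rw [hq]; ring
      _ ≤ q * q := by gcongr
  have h_log : rearr u j ^ 2 / (4 * σ ^ 2) ≤ 2 * Real.log q := by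
    have h := (Real.le_log_iff_exp_le (by positivity)).2 h_exp
    rw [Real.log_mul (by positivity) (by positivity)] at h
    linarith
  have hlog_nonneg : 0 ≤ Real.log q := Real.log_nonneg (by linarith)
  refine (sq_le_sq₀ (rearr_nonneg u j) (by positivity)).1 ?_
  rw [mul_pow, Real.sq_sqrt hlog_nonneg]
  rw [div_le_iff₀ (by positivity)] at h_log
  nlinarith [mul_nonneg hlog_nonneg (sq_nonneg σ)]

/-- If `g₁,…,g_p` are (possibly dependent) centered Gaussian random variables with
variance at most `σ²`, the event `∩_j {g_j* ≤ 4σ√(log(2p/j))}` has probability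
at least `1/2`. -/
theorem stmt18 (p : ℕ) (σ : ℝ) (hσ : 0 < σ)
    (Ω : Type*) [MeasurableSpace Ω] (μ : Measure Ω) [IsProbabilityMeasure μ]
    (g : Fin p → Ω → ℝ)
    (hg : ∀ j : Fin p, ∃ v : ℝ≥0, (v : ℝ) ≤ σ ^ 2 ∧ μ.map (g j) = gaussianReal 0 v) :
    μ {ω | ∀ j : Fin p,
        rearr (fun i => g i ω) j ≤ 4 * σ * Real.sqrt (Real.log (2 * p / ((j : ℕ) + 1)))}
      ≥ 1/2 := by
  rcases Nat.eq_zero_or_pos p with rfl | hp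
  · simp
  have hg_meas : ∀ i, AEMeasurable (g i) μ := fun i => by
    obtain ⟨v, -, h⟩ := hg i
    exact AEMeasurable.of_map_ne_zero (by rw [h]; exact IsProbabilityMeasure.ne_zero _)
  set Y : Ω → ℝ≥0∞ := fun ω => ∑ i, ENNReal.ofReal (Real.exp (g i ω ^ 2 / (4 * σ ^ 2))) with hY
  have hY_meas : ∀ i, AEMeasurable
      (fun ω => ENNReal.ofReal (Real.exp (g i ω ^ 2 / (4 * σ ^ 2)))) μ := fun i =>
    (by fun_prop : Measurable fun x : ℝ =>
      ENNReal.ofReal (Real.exp (x ^ 2 / (4 * σ ^ 2)))).comp_aemeasurable (hg_meas i)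
  have hY_int : ∫⁻ ω, Y ω ∂μ ≤ p * 2 := by
    rw [hY, lintegral_finsetSum' _ fun i _ => hY_meas i]
    calc _ ≤ ∑ _i : Fin p, (2 : ℝ≥0∞) := Finset.sum_le_sum fun i _ => by
          obtain ⟨v, hv, h⟩ := hg i
          rw [← lintegral_map' (f := fun x => ENNReal.ofReal (Real.exp (x ^ 2 / (4 * σ ^ 2))))
            (by fun_prop) (hg_meas i), h]
          exact lintegral_exp_sq_gaussianReal_le hv
      _ = p * 2 := by simp
  have h_markov : μ {ω | p * 4 ≤ Y ω} ≤ 1 / 2 := by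
    have hp0 : (p : ℝ≥0∞) ≠ 0 := by exact_mod_cast hp.ne'
    refine (meas_ge_le_lintegral_div (Finset.aemeasurable_fun_sum _ fun i _ => hY_meas i)
      (by simp [hp0]) (by finiteness)).trans ?_
    refine (ENNReal.div_le_div_right hY_int _).trans ?_
    rw [ENNReal.mul_div_mul_left _ _ hp0 (ENNReal.natCast_ne_top p)]
    refine ENNReal.div_le_of_le_mul ?_
    rw [show (4 : ℝ≥0∞) = 2 * 2 by norm_num, ← mul_assoc,
      ENNReal.div_mul_cancel (by norm_num) (by norm_num), one_mul]
  have h_half : 1 / 2 ≤ μ {ω | p * 4 ≤ Y ω}ᶜ := by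
    have h_add : 1 ≤ μ {ω | p * 4 ≤ Y ω} + μ {ω | p * 4 ≤ Y ω}ᶜ := by
      rw [← measure_univ (μ := μ), ← Set.union_compl_self {ω | p * 4 ≤ Y ω}]
      exact measure_union_le _ _
    have h_le := (ENNReal.add_halves 1).le.trans (h_add.trans (add_le_add_left h_markov _))
    exact (ENNReal.add_le_add_iff_left (by simp)).1 h_le
  refine h_half.trans (measure_mono fun ω hω => rearr_le_of_sum_exp_sq_le hσ ?_)
  have hω' : ∑ i, ENNReal.ofReal (Real.exp (g i ω ^ 2 / (4 * σ ^ 2))) ≤ p * 4 :=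
    (not_le.1 (show ¬p * 4 ≤ Y ω from hω)).le
  rw [← ENNReal.ofReal_sum_of_nonneg fun i _ => (Real.exp_pos _).le] at hω'
  have h_real := ENNReal.toReal_mono (by finiteness) hω'
  rw [ENNReal.toReal_ofReal (by positivity)] at h_real
  simpa [mul_comm] using h_real
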